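/- Let n be an even positive integer and consider the permutations of ℤ/nℤ given by ρ(x) = x + 1 and τ(x) = 3 − x, so that (τρ^i)(x) = 3 − i − x. For any integer i, the number b₂ of blocks of cardinality 2 in the join partition C(ρ^{n/2}) ∨ C(τρ^i) of ℤ/nℤ equals: 1 if n/2 is odd; 2 if n/2 is even and i is odd; and 0 if n/2 is even and i is even. Moreover every block of C(ρ^{n/2}) ∨ C(τρ^i) equals {x, x + n/2, 3 − i − x, 3 − i − x + n/2} for some x, and hence has cardinality 2 or 4. -/

import Mathlib

/-- The partition `C(g)` of `M` into the cycles (`⟨g⟩`-orbits) of a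
permutation `g`, as a setoid. -/
def cyclePartition {M : Type*} (g : Equiv.Perm M) : Setoid M :=
  MulAction.orbitRel (Subgroup.zpowers g) M

/-- `b_k(π)`, the number of blocks of cardinality `k` of a partition
(setoid) `π`. -/
noncomputable def blockCount {M : Type*} (s : Setoid M) (k : ℕ) : ℕ :=
  Nat.card {B : Set M // B ∈ s.classes ∧ Nat.card B = k}

theorem cyclePartition_rel_apply {M : Type*} (g : Equiv.Perm M) (x : M) :
    cyclePartition g x (g x) :=
  (cyclePartition g).symm ⟨⟨g, Subgroup.mem_zpowers g⟩, rfl⟩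

theorem cyclePartition_le {M : Type*} {g : Equiv.Perm M} {s : Setoid M}
    (hs : ∀ x, s x (g x)) : cyclePartition g ≤ s := by
  have hnat : ∀ (k : ℕ) x, s x ((g ^ k) x) := by
    intro k
    induction k with
    | zero => intro x; exact s.refl x
    | succ k ih =>
      intro x
      rw [pow_succ']
      exact s.trans (ih x) (hs _)
  rintro x y ⟨⟨_, k, rfl⟩, rfl⟩
  obtain ⟨k, rfl | rfl⟩ := k.eq_nat_or_neg
  · simpa using s.symm (hnat k y)
  · have := hnat k ((g ^ (-(k : ℤ))) y)
    simpa using this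

/-- The orbit of `x` under the translation by `h` and the reflection `x ↦ c - x`, provided
that `h + h = 0`. -/
def kleinOrbit {R : Type*} [CommRing R] (h c x : R) : Set R :=
  {x, x + h, c - x, c - x + h}

section KleinOrbit

variable {R : Type*} [CommRing R] {h c : R}

theorem mem_kleinOrbit {x y : R} :
    y ∈ kleinOrbit h c x ↔ y = x ∨ y = x + h ∨ y = c - x ∨ y = c - x + h := by
  simp [kleinOrbit]

/-- The partition of `R` into the sets `kleinOrbit h c x`. -/
def kleinSetoid (h c : R) (hh : h + h = 0) : Setoid R where
  r x y := y ∈ kleinOrbit h c x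
  iseqv :=
    { refl := fun x => by simp [mem_kleinOrbit]
      symm := fun {x y} hxy => by
        simp only [mem_kleinOrbit] at hxy ⊢
        grind
      trans := fun {x y z} hxy hyz => by
        simp only [mem_kleinOrbit] at hxy hyz ⊢
        grind }

theorem kleinSetoid_rel (hh : h + h = 0) {x y : R} :
    kleinSetoid h c hh x y ↔ y = x ∨ y = x + h ∨ y = c - x ∨ y = c - x + h :=
  mem_kleinOrbit

theorem cyclePartition_sup_eq_kleinSetoid (hh : h + h = 0) {f g : Equiv.Perm R}
    (hf : ∀ x, f x = x + h) (hg : ∀ x, g x = c - x) :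
    cyclePartition f ⊔ cyclePartition g = kleinSetoid h c hh := by
  apply le_antisymm
  · refine sup_le (cyclePartition_le fun x => ?_) (cyclePartition_le fun x => ?_)
    · simp [kleinSetoid_rel, hf]
    · simp [kleinSetoid_rel, hg]
  · set s := cyclePartition f ⊔ cyclePartition g
    have hsf : ∀ x, s x (x + h) := fun x => by
      rw [← hf]
      exact (le_sup_left : cyclePartition f ≤ s) (cyclePartition_rel_apply f x)
    have hsg : ∀ x, s x (c - x) := fun x => by
      rw [← hg]
      exact (le_sup_right : cyclePartition g ≤ s) (cyclePartition_rel_apply g x)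
    intro x y hxy
    obtain rfl | rfl | rfl | rfl := (kleinSetoid_rel hh).1 hxy
    · exact s.refl _
    · exact hsf x
    · exact hsg x
    · exact s.trans (hsg x) (hsf _)

theorem mem_classes_kleinSetoid (hh : h + h = 0) {B : Set R} :
    B ∈ (kleinSetoid h c hh).classes ↔ ∃ x, B = kleinOrbit h c x := by
  have key : ∀ x, {y | kleinSetoid h c hh y x} = kleinOrbit h c x := fun x =>
    Set.ext fun y => (kleinSetoid h c hh).comm'
  simp only [Setoid.classes, Set.mem_ofPred_eq, key]

theorem kleinOrbit_eq_kleinOrbit_iff (hh : h + h = 0) {x y : R} :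
    kleinOrbit h c x = kleinOrbit h c y ↔
      x = y ∨ x = y + h ∨ x = c - y ∨ x = c - y + h := by
  rw [← mem_kleinOrbit]
  constructor
  · intro hxy
    rw [← hxy]
    simp [mem_kleinOrbit]
  · intro hx
    have hx : kleinSetoid h c hh y x := hx
    ext z
    exact ⟨fun hz => (kleinSetoid h c hh).trans hx hz,
      fun hz => (kleinSetoid h c hh).trans ((kleinSetoid h c hh).symm hx) hz⟩

theorem ncard_kleinOrbit_eq_two (h0 : h ≠ 0) (hh : h + h = 0) {x : R}
    (hx : x + x = c ∨ x + x = c + h) : (kleinOrbit h c x).ncard = 2 := by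
  have : kleinOrbit h c x = {x, x + h} := by
    ext y
    simp only [mem_kleinOrbit, Set.mem_insert_iff, Set.mem_singleton_iff]
    grind
  rw [this, Set.ncard_pair]
  simpa using h0

theorem ncard_kleinOrbit_eq_four (h0 : h ≠ 0) (hh : h + h = 0) {x : R}
    (hx : ¬(x + x = c ∨ x + x = c + h)) : (kleinOrbit h c x).ncard = 4 := by
  rw [kleinOrbit, Set.ncard_insert_of_notMem, Set.ncard_insert_of_notMem, Set.ncard_pair]
  · simpa using h0
  all_goals
    simp only [Set.mem_insert_iff, Set.mem_singleton_iff]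
    grind

theorem blockCount_kleinSetoid_two (h0 : h ≠ 0) (hh : h + h = 0) :
    blockCount (kleinSetoid h c hh) 2 =
      (kleinOrbit h c '' {x | x + x = c ∨ x + x = c + h}).ncard := by
  rw [blockCount, ← Nat.card_coe_set_eq]
  congr 2
  ext B
  rw [Nat.card_coe_set_eq, mem_classes_kleinSetoid]
  constructor
  · rintro ⟨⟨x, rfl⟩, hB⟩
    refine ⟨x, ?_, rfl⟩
    by_contra hx
    have := ncard_kleinOrbit_eq_four h0 hh hx
    omega
  · rintro ⟨x, hx, rfl⟩
    exact ⟨⟨x, rfl⟩, ncard_kleinOrbit_eq_two h0 hh hx⟩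

/-- If `h` is the only element of order two and is not a double, at most one orbit has two
elements. -/
theorem ncard_image_kleinOrbit_eq_one (hh : h + h = 0)
    (htor : ∀ y : R, y + y = 0 → y = 0 ∨ y = h) (hdouble : ∀ y : R, y + y ≠ h) {a : R}
    (ha : a + a = c ∨ a + a = c + h) :
    (kleinOrbit h c '' {x | x + x = c ∨ x + x = c + h}).ncard = 1 := by
  rw [Set.ncard_eq_one]
  refine ⟨kleinOrbit h c a, Set.eq_singleton_iff_unique_mem.2 ⟨⟨a, ha, rfl⟩, ?_⟩⟩
  rintro _ ⟨x, hx, rfl⟩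
  rw [kleinOrbit_eq_kleinOrbit_iff hh]
  have h1 := htor (x - a)
  have h2 := hdouble (x - a)
  simp only [Set.mem_ofPred_eq] at hx
  grind

theorem ncard_image_kleinOrbit_eq_two (h0 : h ≠ 0) (hh : h + h = 0)
    (htor : ∀ y : R, y + y = 0 → y = 0 ∨ y = h) {a k : R}
    (hk : k + k = h) (ha : a + a = c) :
    (kleinOrbit h c '' {x | x + x = c ∨ x + x = c + h}).ncard = 2 := by
  have : kleinOrbit h c '' {x | x + x = c ∨ x + x = c + h} =
      {kleinOrbit h c a, kleinOrbit h c (a + k)} := by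
    ext B
    simp only [Set.mem_image, Set.mem_ofPred_eq, Set.mem_insert_iff, Set.mem_singleton_iff]
    constructor
    · rintro ⟨x, hx, rfl⟩
      rw [kleinOrbit_eq_kleinOrbit_iff hh, kleinOrbit_eq_kleinOrbit_iff hh]
      have h1 := htor (x - a)
      have h2 := htor (x - (a + k))
      grind
    · rintro (rfl | rfl)
      · exact ⟨a, Or.inl ha, rfl⟩
      · exact ⟨a + k, Or.inr (by grind), rfl⟩
  rw [this, Set.ncard_pair]
  clear this htor
  have hk2 : k + k + (h + h) ≠ 0 := by rwa [hh, add_zero, hk]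
  rw [Ne, kleinOrbit_eq_kleinOrbit_iff hh]
  grind

end KleinOrbit

theorem ZMod.eq_zero_or_eq_half_of_add_self_eq_zero {m : ℕ} (hm : 0 < m)
    (y : ZMod (m + m)) (hy : y + y = 0) : y = 0 ∨ y = (m : ZMod (m + m)) := by
  have : NeZero (m + m) := ⟨by omega⟩
  obtain h | h := (ZMod.neg_eq_self_iff y).1 (neg_eq_of_add_eq_zero_left hy)
  · exact Or.inl h
  · right
    rw [← ZMod.natCast_zmod_val y]
    congr 1
    omega

theorem ZMod.even_of_intCast_eq_add_self {m : ℕ} {j : ℤ} {y : ZMod (m + m)}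
    (hy : y + y = (j : ZMod (m + m))) : Even j := by
  have h := congrArg (ZMod.castHom (⟨m, by ring⟩ : 2 ∣ m + m) (ZMod 2)) hy
  rw [map_add, CharTwo.add_self_eq_zero, map_intCast] at h
  rw [even_iff_two_dvd]
  exact (ZMod.intCast_zmod_eq_zero_iff_dvd j 2).1 h.symm

/-- For `n` even, `ρ(x) = x + 1`, `τ(x) = 3 − x` on
`ℤ/nℤ`, and any integer `i`, the number of blocks of cardinality `2` of
`C(ρ^{n/2}) ∨ C(τρ^i)` is `1` if `n/2` is odd, `2` if `n/2` is even and `i`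
is odd, and `0` if `n/2` is even and `i` is even; moreover every block is of
the form `{x, x + n/2, 3 − i − x, 3 − i − x + n/2}` and has cardinality `2`
or `4`. -/
theorem dihedral_join_blocks_even (n : ℕ) (hn : 0 < n) (heven : Even n) (i : ℤ) :
    (let s : Setoid (ZMod n) :=
      cyclePartition ((Equiv.addRight (1 : ZMod n)) ^ (n / 2)) ⊔
        cyclePartition (Equiv.subLeft (3 : ZMod n) * (Equiv.addRight (1 : ZMod n)) ^ i);
     blockCount s 2 = (if Odd (n / 2) then 1 else if Odd i then 2 else 0) ∧
      ∀ B ∈ s.classes,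
        (∃ x : ZMod n,
          B = ({x, x + ((n / 2 : ℕ) : ZMod n), 3 - (i : ZMod n) - x,
                3 - (i : ZMod n) - x + ((n / 2 : ℕ) : ZMod n)} : Set (ZMod n))) ∧
        (Nat.card B = 2 ∨ Nat.card B = 4)) := by
  obtain ⟨m, rfl⟩ := heven
  have hm : 0 < m := by omega
  have hdiv : (m + m) / 2 = m := by omega
  simp only [hdiv]
  have hh : (m : ZMod (m + m)) + m = 0 := by
    exact_mod_cast ZMod.natCast_self (m + m)
  have h0 : (m : ZMod (m + m)) ≠ 0 := by
    rw [Ne, ZMod.natCast_eq_zero_iff]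
    exact fun h => absurd (Nat.le_of_dvd hm h) (by omega)
  have htor := ZMod.eq_zero_or_eq_half_of_add_self_eq_zero hm
  rw [cyclePartition_sup_eq_kleinSetoid (c := 3 - (i : ZMod (m + m))) hh
    (fun x => by simp) (fun x => by simp; ring)]
  constructor
  · rw [blockCount_kleinSetoid_two h0 hh]
    have hcast : ∀ a j : ℤ, j = a + a → (a : ZMod (m + m)) + a = j := by
      rintro a _ rfl
      push_cast
      rfl
    split_ifs with hmo hi
    · have hdouble : ∀ y : ZMod (m + m), y + y ≠ m := fun y hy => by
        have := ZMod.even_of_intCast_eq_add_self (j := m) (by simpa using hy)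
        grind
      obtain hi | hi := Int.even_or_odd i
      · obtain ⟨a, ha⟩ : Even (3 - i + m) := by grind
        refine ncard_image_kleinOrbit_eq_one hh htor hdouble (a := (a : ZMod (m + m)))
          (Or.inr ?_)
        simpa using hcast a _ ha
      · obtain ⟨a, ha⟩ : Even (3 - i) := by grind
        refine ncard_image_kleinOrbit_eq_one hh htor hdouble (a := (a : ZMod (m + m)))
          (Or.inl ?_)
        simpa using hcast a _ ha
    · obtain ⟨k, hk⟩ := Nat.not_odd_iff_even.1 hmo
      obtain ⟨a, ha⟩ : Even (3 - i) := by grind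
      refine ncard_image_kleinOrbit_eq_two h0 hh htor (a := (a : ZMod (m + m)))
        (k := (k : ZMod (m + m))) ?_ ?_
      · rw [← Nat.cast_add, ← hk]
      · simpa using hcast a _ ha
    · convert Set.ncard_empty (Set (ZMod (m + m)))
      rw [Set.image_eq_empty, Set.eq_empty_iff_forall_notMem]
      rintro x (hx | hx)
      · have := ZMod.even_of_intCast_eq_add_self (j := 3 - i) (by simpa using hx)
        grind
      · have := ZMod.even_of_intCast_eq_add_self (j := 3 - i + m) (by simpa using hx)
        grind
  · intro B hB
    obtain ⟨x, rfl⟩ := (mem_classes_kleinSetoid hh).1 hB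
    refine ⟨⟨x, rfl⟩, ?_⟩
    rw [Nat.card_coe_set_eq]
    by_cases hx : x + x = 3 - (i : ZMod (m + m)) ∨ x + x = 3 - (i : ZMod (m + m)) + m
    · exact Or.inl (ncard_kleinOrbit_eq_two h0 hh hx)
    · exact Or.inr (ncard_kleinOrbit_eq_four h0 hh hx)
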